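/- Let Ω ⊂ ℝⁿ be a bounded open set and let u ∈ W^{s,p(·,·)}(ℝⁿ) be a weak subsolution of (−Δ)^s_{p(·,·)}u = 0 in Ω. Then for every x₀ and every 0 < r < R with B_R(x₀) ⊆ Ω, and every k ∈ ℝ, writing w₊ = (u−k)₊ and w₋ = (u−k)₋, there exists a constant C > 0, depending only on p₊(B_R(x₀)×B_R(x₀)) and p₋(B_R(x₀)×B_R(x₀)), such that: ∫_{B_r(x₀)}∫_{B_r(x₀)} |w₊(x)−w₊(y)|^{p(x,y)} |x−y|^{−n−s·p(x,y)} dy dx + ∫_{B_r(x₀)} w₊(x) ∫_{B_R(x₀)} w₋(y)^{p(x,y)−1} |x−y|^{−n−s·p(x,y)} dy dx ≤ C ∫_{B_R(x₀)}∫_{B_R(x₀)} (w₊(x)/(R−r))^{p(x,y)} |x−y|^{(1−s)p(x,y)−n} dy dx + C · ( sup_{x∈B_{(R+r)/2}(x₀)} ∫_{ℝⁿ∖B_R(x₀)} w₊(y)^{p(x,y)−1} |y−x₀|^{−n−s·p(x,y)} (2R/(R−r))^{n+s·p(x,y)} dy ) · ∫_{B_R(x₀)} w₊(x) dx. -/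

import Mathlib

open MeasureTheory Metric Set Filter
open scoped ENNReal Topology
noncomputable section

/-- `ℝⁿ` with the Euclidean norm and Lebesgue measure. -/
abbrev Rn (n : ℕ) := EuclideanSpace ℝ (Fin n)

/-- `p₊(E × F) = sup_{x ∈ E, y ∈ F} p(x,y)`. -/
def pSup {n : ℕ} (p : Rn n → Rn n → ℝ) (E F : Set (Rn n)) : ℝ :=
  sSup (Set.image2 p E F)

/-- `p₋(E × F) = inf_{x ∈ E, y ∈ F} p(x,y)`. -/
def pInf {n : ℕ} (p : Rn n → Rn n → ℝ) (E F : Set (Rn n)) : ℝ :=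
  sInf (Set.image2 p E F)

/-- Standing assumptions on the variable exponent: continuity, symmetry and
`1 < inf p ≤ sup p < ∞`. -/
def ExponentOK {n : ℕ} (p : Rn n → Rn n → ℝ) : Prop :=
  Continuous (fun z : Rn n × Rn n => p z.1 z.2) ∧ (∀ x y, p x y = p y x) ∧
    ∃ pm pM : ℝ, 1 < pm ∧ ∀ x y, pm ≤ p x y ∧ p x y ≤ pM

/-- Membership in the fractional Sobolev space `W^{s,p(·,·)}(ℝⁿ)`. -/
def MemW {n : ℕ} (s : ℝ) (p : Rn n → Rn n → ℝ) (u : Rn n → ℝ) : Prop :=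
  Measurable u ∧
    (∫⁻ x, ENNReal.ofReal (|u x| ^ p x x)) < ⊤ ∧
    (∫⁻ x, ∫⁻ y, ENNReal.ofReal (|u x - u y| ^ p x y / ‖x - y‖ ^ ((n : ℝ) + s * p x y))) < ⊤

/-- Weak subsolution of `(-Δ)^s_{p(·,·)} u = 0` in `Ω`. -/
def IsWeakSubsol {n : ℕ} (s : ℝ) (p : Rn n → Rn n → ℝ) (Ω : Set (Rn n)) (u : Rn n → ℝ) : Prop :=
  ∀ φ : Rn n → ℝ, MemW s p φ → (∀ x, 0 ≤ φ x) → (∀ᵐ x, x ∉ Ω → φ x = 0) →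
    (∫ x, ∫ y, |u x - u y| ^ (p x y - 2) * (u x - u y) * (φ x - φ y)
      / ‖x - y‖ ^ ((n : ℝ) + s * p x y)) ≤ 0

/-- Weak supersolution of `(-Δ)^s_{p(·,·)} u = 0` in `Ω`. -/
def IsWeakSupersol {n : ℕ} (s : ℝ) (p : Rn n → Rn n → ℝ) (Ω : Set (Rn n)) (u : Rn n → ℝ) : Prop :=
  ∀ φ : Rn n → ℝ, MemW s p φ → (∀ x, 0 ≤ φ x) → (∀ᵐ x, x ∉ Ω → φ x = 0) →
    0 ≤ (∫ x, ∫ y, |u x - u y| ^ (p x y - 2) * (u x - u y) * (φ x - φ y)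
      / ‖x - y‖ ^ ((n : ℝ) + s * p x y))

/-- Weak solution of `(-Δ)^s_{p(·,·)} u = 0` in `Ω`. -/
def IsWeakSol {n : ℕ} (s : ℝ) (p : Rn n → Rn n → ℝ) (Ω : Set (Rn n)) (u : Rn n → ℝ) : Prop :=
  IsWeakSubsol s p Ω u ∧ IsWeakSupersol s p Ω u

/-- Condition (P1) in `Ω` with constant `L`. -/
def CondP1 {n : ℕ} (p : Rn n → Rn n → ℝ) (Ω : Set (Rn n)) (L : ℝ) : Prop :=
  ∀ (x₀ : Rn n) (R : ℝ), 0 < R → closedBall x₀ R ⊆ Ω →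
    R ^ (pInf p (ball x₀ R) (ball x₀ R) - pSup p (ball x₀ R) (ball x₀ R)) ≤ L

/-- Condition (P2) in `Ω`. -/
def CondP2 {n : ℕ} (p : Rn n → Rn n → ℝ) (Ω : Set (Rn n)) : Prop :=
  ∀ (x₀ : Rn n) (R : ℝ), 0 < R → closedBall x₀ R ⊆ Ω →
    pSup p (ball x₀ R) ((ball x₀ R)ᶜ) ≤ pSup p (ball x₀ R) (ball x₀ R) ∧
    pInf p (ball x₀ R) ((ball x₀ R)ᶜ) ≤ pInf p (ball x₀ R) (ball x₀ R)

lemma rpow_sub_one_mul_self {a p : ℝ} (ha : 0 ≤ a) (hp : 1 < p) : a ^ (p - 1) * a = a ^ p := by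
  have := Real.rpow_add_one' ha (y := p - 1) (by linarith)
  rw [← this]; congr 1; ring

lemma rpow_sub_one_mul_le {a b p : ℝ} (ha : 0 ≤ a) (hb : 0 ≤ b) (hp : 1 < p) :
    a ^ (p - 1) * b ≤ 1 / 2 * a ^ p + 2 ^ (p - 1) * b ^ p := by
  have h1 : 0 ≤ a ^ p := by positivity
  have h2 : 0 ≤ (2 : ℝ) ^ (p - 1) * b ^ p := by positivity
  rcases le_total b (a / 2) with h | h
  · have : a ^ (p - 1) * b ≤ a ^ (p - 1) * (a / 2) := by gcongr
    have := rpow_sub_one_mul_self ha hp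
    linarith
  · have : a ^ (p - 1) * b ≤ (2 * b) ^ (p - 1) * b := by
      gcongr
      linarith
    rw [Real.mul_rpow (by norm_num) hb, mul_assoc, rpow_sub_one_mul_self hb hp] at this
    linarith

lemma rpow_sub_one_mul_weight_le {a c β p q : ℝ} (ha : 0 ≤ a) (hc : 0 ≤ c) (hβ : 0 ≤ β)
    (hβ1 : β ≤ 1) (hp : 1 < p) (hpq : p ≤ q) :
    a ^ (p - 1) * (c * β ^ (q - 1)) ≤ 1 / 2 * (a ^ p * β ^ q) + 2 ^ (p - 1) * c ^ p := by
  have h := mul_le_mul_of_nonneg_right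
    (rpow_sub_one_mul_le (mul_nonneg ha hβ) hc hp) (Real.rpow_nonneg hβ (q - p))
  have e1 : β ^ (q - 1) = β ^ (p - 1) * β ^ (q - p) := by
    rw [← Real.rpow_add_of_nonneg hβ (by linarith) (by linarith)]; congr 1; ring
  have e2 : β ^ q = β ^ p * β ^ (q - p) := by
    rw [← Real.rpow_add_of_nonneg hβ (by linarith) (by linarith)]; congr 1; ring
  rw [Real.mul_rpow ha hβ, Real.mul_rpow ha hβ] at h
  have h3 : β ^ (q - p) ≤ 1 := Real.rpow_le_one hβ hβ1 (by linarith)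
  have h4 : 2 ^ (p - 1) * c ^ p * β ^ (q - p) ≤ 2 ^ (p - 1) * c ^ p :=
    mul_le_of_le_one_right (by positivity) h3
  rw [e1, e2]
  nlinarith

lemma rpow_sub_rpow_le {α β q : ℝ} (hα : 0 ≤ α) (hαβ : α ≤ β) (hq : 1 ≤ q) :
    β ^ q - α ^ q ≤ q * (β - α) * β ^ (q - 1) := by
  rcases (hα.trans hαβ).eq_or_lt with h | h
  · obtain rfl : α = β := by linarith
    simp
  · have hb := one_add_mul_self_le_rpow_one_add (s := α / β - 1) (p := q)
      (by have : 0 ≤ α / β := by positivity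
          linarith) hq
    have e : 1 + (α / β - 1) = α / β := by ring
    rw [e, Real.div_rpow hα h.le, le_div_iff₀ (by positivity)] at hb
    have e1 : β ^ q = β ^ (q - 1) * β := by
      rw [← Real.rpow_add_one h.ne']; congr 1; ring
    have e2 : (1 + q * (α / β - 1)) * β ^ q = β ^ q - q * (β - α) * β ^ (q - 1) := by
      rw [e1]; field_simp; ring
    linarith

/-- Truncation of `(t - k)₊` at height `m`. -/
def truncPos (k m t : ℝ) : ℝ := min (max (t - k) 0) m

lemma truncPos_nonneg {k m : ℝ} (hm : 0 ≤ m) (t : ℝ) : 0 ≤ truncPos k m t :=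
  le_min (le_max_right _ _) hm

lemma truncPos_mono {k m a b : ℝ} (h : b ≤ a) : truncPos k m b ≤ truncPos k m a := by
  unfold truncPos; gcongr

lemma truncPos_le (k m t : ℝ) : truncPos k m t ≤ max (t - k) 0 := min_le_left _ _

lemma abs_truncPos_sub_le (k m a b : ℝ) : |truncPos k m a - truncPos k m b| ≤ |a - b| := by
  unfold truncPos
  refine (abs_min_sub_min_le_max _ _ _ _).trans ?_
  simp only [sub_self, abs_zero]
  refine max_le ?_ (abs_nonneg _)
  refine (abs_max_sub_max_le_max _ _ _ _).trans ?_
  simp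

/-- The crude lower bound, without the truncation level entering. -/
lemma core_lower {a b k m p q α β : ℝ} (hab : b ≤ a) (hm : 0 ≤ m) (hp : 1 < p) (hpq : p ≤ q)
    (hα : 0 ≤ α) (hβ : 0 ≤ β) (hβ1 : β ≤ 1) :
    0 ≤ (a - b) ^ (p - 1) * (truncPos k m a * α ^ q - truncPos k m b * β ^ q)
      + 1 / 2 * (a - b) ^ p + 2 ^ (p - 1) * (q * |α - β| * max (a - k) 0) ^ p := by
  have hd : 0 ≤ a - b := by linarith
  have hv := truncPos_mono (k := k) (m := m) hab
  have hvb := truncPos_nonneg (k := k) hm b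
  have hva := truncPos_nonneg (k := k) hm a
  have hW : 0 ≤ max (a - k) 0 := le_max_right _ _
  have hq : 0 ≤ q := by linarith
  rcases le_total β α with h | h
  · have h1 : truncPos k m b * β ^ q ≤ truncPos k m a * α ^ q := by gcongr
    have : 0 ≤ truncPos k m a * α ^ q - truncPos k m b * β ^ q := by linarith
    positivity
  · have h0 := rpow_sub_rpow_le hα h (by linarith : 1 ≤ q)
    have hβq : β ^ (q - 1) ≤ 1 := Real.rpow_le_one hβ hβ1 (by linarith)
    have hΔ : |α - β| = β - α := by rw [abs_sub_comm]; exact abs_of_nonneg (by linarith)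
    rw [hΔ]
    have hD : 0 ≤ β - α := by linarith
    have h1 : β ^ q - α ^ q ≤ q * (β - α) := h0.trans (mul_le_of_le_one_right (by positivity) hβq)
    have h2 : -(q * (β - α) * max (a - k) 0) ≤ truncPos k m a * α ^ q - truncPos k m b * β ^ q := by
      have h3 : truncPos k m b * β ^ q ≤ truncPos k m a * β ^ q := by gcongr
      have h4 : truncPos k m a * (β ^ q - α ^ q) ≤ max (a - k) 0 * (q * (β - α)) :=
        (mul_le_mul_of_nonneg_left h1 hva).trans
          (mul_le_mul_of_nonneg_right (truncPos_le _ _ _) (by positivity))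
      linarith
    have h5 := rpow_sub_one_mul_le hd (by positivity : 0 ≤ q * (β - α) * max (a - k) 0) hp
    have h6 := mul_le_mul_of_nonneg_left h2 (Real.rpow_nonneg hd (p - 1))
    linarith

/-- The coercive lower bound below the truncation level. -/
lemma core_coercive {a b k m p q α β : ℝ} (hab : b ≤ a) (hp : 1 < p) (hpq : p ≤ q)
    (hα : 0 ≤ α) (hβ : 0 ≤ β) (hβ1 : β ≤ 1) (ham : max (a - k) 0 ≤ m) :
    1 / 2 * ((max (a - k) 0 - max (b - k) 0) ^ p * α ^ q
        + max (a - k) 0 * max (k - b) 0 ^ (p - 1) * α ^ q)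
      ≤ (a - b) ^ (p - 1) * (truncPos k m a * α ^ q - truncPos k m b * β ^ q)
        + 2 ^ (p - 1) * (q * |α - β| * max (a - k) 0) ^ p := by
  have hd : 0 ≤ a - b := by linarith
  have hq : 0 ≤ q := by linarith
  have hbm : max (b - k) 0 ≤ m := le_trans (by gcongr) ham
  have e1 : truncPos k m a = max (a - k) 0 := min_eq_left ham
  have e2 : truncPos k m b = max (b - k) 0 := min_eq_left hbm
  rw [e1, e2]
  have hp0 : p - 1 ≠ 0 := by linarith
  rcases le_total a k with hak | hak
  · have hz : max (a - k) 0 = 0 := max_eq_right (by linarith)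
    have hz' : max (b - k) 0 = 0 := max_eq_right (by linarith)
    rw [hz, hz', sub_zero, Real.zero_rpow (by linarith)]
    simp [Real.zero_rpow (by linarith : p ≠ 0)]
  have hWa : max (a - k) 0 = a - k := max_eq_left (by linarith)
  rw [hWa]
  have hW0 : 0 ≤ a - k := by linarith
  rcases le_total b k with hbk | hbk
  · have hz' : max (b - k) 0 = 0 := max_eq_right (by linarith)
    rw [hz', max_eq_left (by linarith : 0 ≤ k - b), sub_zero, zero_mul, sub_zero]
    have hkb : 0 ≤ k - b := by linarith
    have h1 : (a - k) ^ (p - 1) ≤ (a - b) ^ (p - 1) :=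
      Real.rpow_le_rpow hW0 (by linarith) (by linarith)
    have h2 : (k - b) ^ (p - 1) ≤ (a - b) ^ (p - 1) :=
      Real.rpow_le_rpow hkb (by linarith) (by linarith)
    have h3 := mul_le_mul_of_nonneg_right h1 (by positivity : 0 ≤ (a - k) * α ^ q)
    have h4 := mul_le_mul_of_nonneg_right h2 (by positivity : 0 ≤ (a - k) * α ^ q)
    rw [← rpow_sub_one_mul_self hW0 hp]
    have h5 : 0 ≤ 2 ^ (p - 1) * (q * |α - β| * (a - k)) ^ p := by positivity
    linarith
  · have hWb : max (b - k) 0 = b - k := max_eq_left (by linarith)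
    have hb0 : 0 ≤ b - k := by linarith
    rw [hWb, max_eq_right (by linarith : k - b ≤ 0), Real.zero_rpow hp0,
      show a - k - (b - k) = a - b by ring]
    have h5 : 0 ≤ 2 ^ (p - 1) * (q * |α - β| * (a - k)) ^ p := by positivity
    have h7 := rpow_sub_one_mul_self hd hp
    rcases le_total β α with h | h
    · have h1 : (b - k) * β ^ q ≤ (b - k) * α ^ q := by gcongr
      have h6 : (a - b) ^ (p - 1) * ((a - b) * α ^ q)
          ≤ (a - b) ^ (p - 1) * ((a - k) * α ^ q - (b - k) * β ^ q) := by
        gcongr; linarith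
      have h8 : 0 ≤ (a - b) ^ p * α ^ q := by positivity
      rw [← mul_assoc, h7] at h6
      linarith
    · have h0 := rpow_sub_rpow_le hα h (by linarith : 1 ≤ q)
      have hΔ : |α - β| = β - α := by rw [abs_sub_comm]; exact abs_of_nonneg (by linarith)
      rw [hΔ] at h5 ⊢
      have hD : 0 ≤ β - α := by linarith
      have h9 := rpow_sub_one_mul_weight_le hd (by positivity : 0 ≤ q * (β - α) * (a - k)) hβ hβ1
        hp hpq
      have h10 : (a - b) * β ^ q - q * (β - α) * (a - k) * β ^ (q - 1)
          ≤ (a - k) * α ^ q - (b - k) * β ^ q := by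
        have := mul_le_mul_of_nonneg_left h0 hW0
        linarith
      have h11 := mul_le_mul_of_nonneg_left h10 (Real.rpow_nonneg hd (p - 1))
      have h12 : (a - b) ^ p * α ^ q ≤ (a - b) ^ p * β ^ q := by gcongr
      have h13 : (a - b) ^ (p - 1) * ((a - b) * β ^ q) = (a - b) ^ p * β ^ q := by
        rw [← mul_assoc, h7]
      rw [mul_sub, h13] at h11
      linarith

/-- A radial kernel that is integrable near the origin and at infinity. -/
def radialKernel (n : ℕ) (c d t : ℝ) : ℝ := if t ≤ 1 then t ^ (c - n) else t ^ (-n - d)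

lemma radialKernel_nonneg (n : ℕ) (c d : ℝ) {t : ℝ} (ht : 0 ≤ t) : 0 ≤ radialKernel n c d t := by
  unfold radialKernel; split_ifs <;> positivity

lemma measurable_radialKernel (n : ℕ) (c d : ℝ) : Measurable (radialKernel n c d) := by
  unfold radialKernel
  exact Measurable.ite measurableSet_Iic (measurable_id.pow_const _) (measurable_id.pow_const _)

lemma integrable_radialKernel {n : ℕ} (hn : 1 ≤ n) {c d : ℝ} (hc : 0 < c) (hd : 0 < d) :
    Integrable (fun x : Rn n => radialKernel n c d ‖x‖) := by
  have : Nonempty (Fin n) := ⟨⟨0, hn⟩⟩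
  rw [integrable_fun_norm_addHaar]
  simp only [finrank_euclideanSpace, Fintype.card_fin, smul_eq_mul]
  have hcast : ((n - 1 : ℕ) : ℝ) = n - 1 := by push_cast [hn]; ring
  rw [← Ioc_union_Ioi_eq_Ioi (zero_le_one' ℝ)]
  refine IntegrableOn.union ?_ ?_
  · have h := (intervalIntegral.intervalIntegrable_rpow' (a := 0) (b := 1)
      (by linarith : -1 < c - 1))
    rw [intervalIntegrable_iff_integrableOn_Ioc_of_le zero_le_one] at h
    refine h.congr_fun (fun t ht => ?_) measurableSet_Ioc
    simp only [radialKernel, ht.2, if_true]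
    rw [← Real.rpow_natCast, ← Real.rpow_add ht.1, hcast]; congr 1; ring
  · have h := integrableOn_Ioi_rpow_of_lt (by linarith : -1 - d < -1) one_pos
    refine h.congr_fun (fun t ht => ?_) measurableSet_Ioi
    simp only [radialKernel, not_le.2 (mem_Ioi.1 ht), if_false]
    rw [← Real.rpow_natCast, ← Real.rpow_add (one_pos.trans (mem_Ioi.1 ht)), hcast]; congr 1; ring

lemma rpow_div_le_radialKernel {n : ℕ} {s p pm pM L a t : ℝ} (hs : 0 < s) (hs1 : s < 1)
    (hpm : 1 < pm) (h1 : pm ≤ p) (h2 : p ≤ pM) (hL : 1 ≤ L) (ht : 0 ≤ t) (ha : 0 ≤ a)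
    (ha1 : a ≤ 1) (haL : a ≤ L * t) :
    a ^ p / t ^ ((n : ℝ) + s * p) ≤ L ^ pM * radialKernel n ((1 - s) * pm) (s * pm) t := by
  have hp : 0 < p := by linarith
  have hk := radialKernel_nonneg n ((1 - s) * pm) (s * pm) ht
  have hLM : 1 ≤ L ^ pM := Real.one_le_rpow hL (by linarith)
  rcases ht.eq_or_lt with rfl | ht
  · have : a = 0 := by linarith
    rw [this, Real.zero_rpow hp.ne', zero_div]; positivity
  unfold radialKernel at hk ⊢
  split_ifs at hk ⊢ with h
  · have e1 : a ^ p ≤ L ^ pM * t ^ p := by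
      calc a ^ p ≤ (L * t) ^ p := by gcongr
        _ = L ^ p * t ^ p := Real.mul_rpow (by linarith) ht.le
        _ ≤ L ^ pM * t ^ p := by gcongr
    calc a ^ p / t ^ ((n : ℝ) + s * p) ≤ L ^ pM * t ^ p / t ^ ((n : ℝ) + s * p) := by gcongr
      _ = L ^ pM * t ^ ((1 - s) * p - n) := by
        rw [mul_div_assoc, ← Real.rpow_sub ht]; congr 2; ring
      _ ≤ _ := by
        gcongr L ^ pM * ?_
        apply Real.rpow_le_rpow_of_exponent_ge ht h
        nlinarith
  · push Not at h
    have e1 : a ^ p ≤ 1 := Real.rpow_le_one ha ha1 hp.le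
    calc a ^ p / t ^ ((n : ℝ) + s * p) ≤ 1 / t ^ ((n : ℝ) + s * p) := by gcongr
      _ = t ^ (-((n : ℝ) + s * p)) := by rw [Real.rpow_neg ht.le, one_div]
      _ ≤ t ^ (-(n : ℝ) - s * pm) := by
        apply Real.rpow_le_rpow_of_exponent_le h.le
        nlinarith
      _ ≤ _ := le_mul_of_one_le_left hk hLM

lemma lintegral_cutoff_lt_top {n : ℕ} (hn : 1 ≤ n) {s : ℝ} (hs : s ∈ Ioo (0 : ℝ) 1)
    {p : Rn n → Rn n → ℝ} (hp : ExponentOK p) {ζ : Rn n → ℝ} (h0 : ∀ x, 0 ≤ ζ x)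
    (h1 : ∀ x, ζ x ≤ 1) {L : ℝ} (hL : 1 ≤ L) (hLip : ∀ x y, |ζ x - ζ y| ≤ L * ‖x - y‖)
    {x₀ : Rn n} {R : ℝ} (hζ : ∀ x, x ∉ ball x₀ R → ζ x = 0) :
    (∫⁻ x, ∫⁻ y, ENNReal.ofReal (|ζ x - ζ y| ^ p x y / ‖x - y‖ ^ ((n : ℝ) + s * p x y))) < ⊤ := by
  obtain ⟨-, -, pm, pM, hpm, hb⟩ := hp
  set κ : Rn n → ℝ≥0∞ := fun x => ENNReal.ofReal (L ^ pM *
    radialKernel n ((1 - s) * pm) (s * pm) ‖x‖) with hκ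
  have hκm : Measurable κ :=
    (((measurable_radialKernel _ _ _).comp measurable_norm).const_mul _).ennreal_ofReal
  have hκi : ∫⁻ x, κ x < ⊤ :=
    ((integrable_radialKernel hn (by nlinarith [hs.1, hs.2]) (by nlinarith [hs.1])).const_mul
      (L ^ pM)).lintegral_lt_top
  set B := ball x₀ R
  have hpt : ∀ x y, ENNReal.ofReal (|ζ x - ζ y| ^ p x y / ‖x - y‖ ^ ((n : ℝ) + s * p x y))
      ≤ B.indicator 1 x * κ (x - y) + B.indicator 1 y * κ (x - y) := by
    intro x y
    by_cases hxy : x ∈ B ∨ y ∈ B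
    · have : ENNReal.ofReal (|ζ x - ζ y| ^ p x y / ‖x - y‖ ^ ((n : ℝ) + s * p x y)) ≤ κ (x - y) :=
        ENNReal.ofReal_le_ofReal (rpow_div_le_radialKernel hs.1 hs.2 hpm (hb x y).1 (hb x y).2 hL
          (norm_nonneg _) (abs_nonneg _)
          (abs_sub_le_iff.2 ⟨by linarith [h0 y, h1 x], by linarith [h0 x, h1 y]⟩) (hLip x y))
      refine this.trans ?_
      rcases hxy with h | h
      · simp [h]
      · simp [h]
    · push Not at hxy
      rw [hζ x hxy.1, hζ y hxy.2, sub_self, abs_zero,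
        Real.zero_rpow (by linarith [(hb x y).1]), zero_div, ENNReal.ofReal_zero]
      exact zero_le
  have hBm : MeasurableSet B := measurableSet_ball
  have hind : Measurable (B.indicator (1 : Rn n → ℝ≥0∞)) := measurable_one.indicator hBm
  have hBi : ∫⁻ x, B.indicator (1 : Rn n → ℝ≥0∞) x = volume B := by
    simp [lintegral_indicator hBm]
  have hBv : volume B < ⊤ := measure_ball_lt_top
  calc _ ≤ ∫⁻ x, ∫⁻ y, (B.indicator 1 x * κ (x - y) + B.indicator 1 y * κ (x - y)) :=
        lintegral_mono fun x => lintegral_mono fun y => hpt x y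
    _ = (∫⁻ x, ∫⁻ y, B.indicator 1 x * κ (x - y)) + ∫⁻ x, ∫⁻ y, B.indicator 1 y * κ (x - y) := by
        rw [← lintegral_add_left]
        · congr 1; ext x
          rw [lintegral_add_left]
          exact (hκm.comp (measurable_const.sub measurable_id)).const_mul _
        · apply Measurable.lintegral_prod_right'
            (f := fun z : Rn n × Rn n => B.indicator 1 z.1 * κ (z.1 - z.2))
          exact (hind.comp measurable_fst).mul (hκm.comp (measurable_fst.sub measurable_snd))
    _ = (∫⁻ x, B.indicator 1 x * ∫⁻ y, κ (x - y)) + ∫⁻ y, B.indicator 1 y * ∫⁻ x, κ (x - y) := by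
        congr 1
        · congr 1; ext x
          rw [lintegral_const_mul]
          exact (hκm.comp (measurable_const.sub measurable_id))
        · rw [lintegral_lintegral_swap]
          · congr 1; ext x
            rw [lintegral_const_mul]
            exact (hκm.comp (measurable_id.sub measurable_const))
          · exact ((hind.comp measurable_snd).mul
              (hκm.comp (measurable_fst.sub measurable_snd))).aemeasurable
    _ = volume B * (∫⁻ x, κ x) + volume B * ∫⁻ x, κ x := by
        simp_rw [lintegral_sub_left_eq_self, lintegral_sub_right_eq_self]
        rw [lintegral_mul_const _ hind, hBi]
    _ < ⊤ := by
        have := ENNReal.mul_lt_top hBv hκi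
        exact ENNReal.add_lt_top.2 ⟨this, this⟩

lemma measurable_quotient {n : ℕ} {s : ℝ} {p : Rn n → Rn n → ℝ}
    (hpc : Continuous fun z : Rn n × Rn n => p z.1 z.2) {g : Rn n × Rn n → ℝ}
    (hg : Measurable g) :
    Measurable fun z : Rn n × Rn n => g z / ‖z.1 - z.2‖ ^ ((n : ℝ) + s * p z.1 z.2) :=
  hg.div ((measurable_fst.sub measurable_snd).norm.pow
    ((hpc.measurable.const_mul s).const_add (n : ℝ)))

lemma measurable_gagliardo {n : ℕ} {s : ℝ} {p : Rn n → Rn n → ℝ}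
    (hpc : Continuous fun z : Rn n × Rn n => p z.1 z.2) {f : Rn n → ℝ} (hf : Measurable f) :
    Measurable fun z : Rn n × Rn n =>
      ENNReal.ofReal (|f z.1 - f z.2| ^ p z.1 z.2 / ‖z.1 - z.2‖ ^ ((n : ℝ) + s * p z.1 z.2)) := by
  have h1 : Measurable fun z : Rn n × Rn n => |f z.1 - f z.2| :=
    ((hf.comp measurable_fst).sub (hf.comp measurable_snd)).norm
  exact (measurable_quotient hpc (h1.pow hpc.measurable)).ennreal_ofReal

lemma lintegral_lintegral_lt_top_of_le {X : Type*} [MeasurableSpace X] {μ : Measure X} [SFinite μ]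
    {f g h : X → X → ℝ≥0∞} {c : ℝ≥0∞} (hf : Measurable fun z : X × X => f z.1 z.2)
    (hg : Measurable fun z : X × X => g z.1 z.2) (hc : c ≠ ⊤)
    (hfi : ∫⁻ x, ∫⁻ y, f x y ∂μ ∂μ < ⊤) (hgi : ∫⁻ x, ∫⁻ y, g x y ∂μ ∂μ < ⊤)
    (hle : ∀ x y, h x y ≤ c * f x y + c * g x y) : ∫⁻ x, ∫⁻ y, h x y ∂μ ∂μ < ⊤ := by
  refine (lintegral_mono fun x => lintegral_mono fun y => hle x y).trans_lt ?_
  rw [← lintegral_prod (fun z : X × X => c * f z.1 z.2 + c * g z.1 z.2)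
    ((hf.const_mul c).add (hg.const_mul c)).aemeasurable, lintegral_add_left (hf.const_mul c),
    lintegral_const_mul c hf, lintegral_const_mul c hg, lintegral_prod _ hf.aemeasurable,
    lintegral_prod _ hg.aemeasurable]
  exact ENNReal.add_lt_top.2 ⟨ENNReal.mul_lt_top hc.lt_top hfi, ENNReal.mul_lt_top hc.lt_top hgi⟩

lemma memW_truncPos_mul {n : ℕ} (hn : 1 ≤ n) {s : ℝ} (hs : s ∈ Ioo (0 : ℝ) 1)
    {p : Rn n → Rn n → ℝ} (hp : ExponentOK p) {u : Rn n → ℝ} (hu : MemW s p u) {k m : ℝ}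
    (hm : 1 ≤ m) {ζ : Rn n → ℝ} (hζm : Measurable ζ) (h0 : ∀ x, 0 ≤ ζ x)
    (h1 : ∀ x, ζ x ≤ 1) {L : ℝ} (hL : 1 ≤ L) (hLip : ∀ x y, |ζ x - ζ y| ≤ L * ‖x - y‖)
    {x₀ : Rn n} {R : ℝ} (hζ : ∀ x, x ∉ ball x₀ R → ζ x = 0) :
    MemW s p (fun x => truncPos k m (u x) * ζ x) := by
  have hcut := lintegral_cutoff_lt_top hn hs hp h0 h1 hL hLip hζ
  obtain ⟨hpc, -, pm, pM, hpm, hb⟩ := hp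
  have hv0 : ∀ x, 0 ≤ truncPos k m (u x) := fun x => truncPos_nonneg (by linarith) _
  have hvm : ∀ x, truncPos k m (u x) ≤ m := fun x => min_le_right _ _
  refine ⟨?_, ?_, ?_⟩
  · unfold truncPos
    exact (((hu.1.sub_const k).max measurable_const).min measurable_const).mul hζm
  · have hpt : ∀ x, ENNReal.ofReal (|truncPos k m (u x) * ζ x| ^ p x x)
        ≤ (ball x₀ R).indicator (fun _ => ENNReal.ofReal (m ^ pM)) x := by
      intro x
      by_cases hx : x ∈ ball x₀ R
      · rw [indicator_of_mem hx]
        apply ENNReal.ofReal_le_ofReal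
        rw [abs_of_nonneg (mul_nonneg (hv0 x) (h0 x))]
        calc (truncPos k m (u x) * ζ x) ^ p x x ≤ m ^ p x x := by
              apply Real.rpow_le_rpow (mul_nonneg (hv0 x) (h0 x)) _ (by linarith [(hb x x).1])
              exact (mul_le_of_le_one_right (hv0 x) (h1 x)).trans (hvm x)
          _ ≤ m ^ pM := Real.rpow_le_rpow_of_exponent_le hm (hb x x).2
      · rw [hζ x hx, mul_zero, abs_zero, Real.zero_rpow (by linarith [(hb x x).1])]
        simp
    refine (lintegral_mono hpt).trans_lt ?_
    rw [lintegral_indicator measurableSet_ball, setLIntegral_const]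
    exact ENNReal.mul_lt_top ENNReal.ofReal_lt_top measure_ball_lt_top
  · have hpt : ∀ x y, ENNReal.ofReal (|truncPos k m (u x) * ζ x - truncPos k m (u y) * ζ y| ^ p x y
          / ‖x - y‖ ^ ((n : ℝ) + s * p x y))
        ≤ ENNReal.ofReal ((2 * m) ^ pM) *
            ENNReal.ofReal (|u x - u y| ^ p x y / ‖x - y‖ ^ ((n : ℝ) + s * p x y))
          + ENNReal.ofReal ((2 * m) ^ pM) *
            ENNReal.ofReal (|ζ x - ζ y| ^ p x y / ‖x - y‖ ^ ((n : ℝ) + s * p x y)) := by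
      intro x y
      have hp0 : 0 < p x y := by linarith [(hb x y).1]
      rw [← ENNReal.ofReal_mul (by positivity), ← ENNReal.ofReal_mul (by positivity),
        ← ENNReal.ofReal_add (by positivity) (by positivity)]
      apply ENNReal.ofReal_le_ofReal
      rw [mul_div_assoc', mul_div_assoc', ← add_div, ← mul_add]
      gcongr
      have hA : |truncPos k m (u x) * ζ x - truncPos k m (u y) * ζ y|
          ≤ m * |u x - u y| + m * |ζ x - ζ y| := by
        have e : truncPos k m (u x) * ζ x - truncPos k m (u y) * ζ y
          = (truncPos k m (u x) - truncPos k m (u y)) * ζ x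
            + truncPos k m (u y) * (ζ x - ζ y) := by ring
        rw [e]
        refine (abs_add_le _ _).trans ?_
        rw [abs_mul, abs_mul, abs_of_nonneg (h0 x), abs_of_nonneg (hv0 y)]
        have t1 := abs_truncPos_sub_le k m (u x) (u y)
        have t2 := mul_le_of_le_one_right (abs_nonneg (truncPos k m (u x) - truncPos k m (u y)))
          (h1 x)
        have t3 := mul_le_mul_of_nonneg_right (hvm y) (abs_nonneg (ζ x - ζ y))
        have t4 := le_mul_of_one_le_left (abs_nonneg (u x - u y)) hm
        linarith
      set a := |u x - u y|
      set b := |ζ x - ζ y|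
      have ha : 0 ≤ a := abs_nonneg _
      have hb' : 0 ≤ b := abs_nonneg _
      have hB : m * a + m * b ≤ 2 * m * max a b := by
        nlinarith [le_max_left a b, le_max_right a b]
      calc _ ≤ (2 * m * max a b) ^ p x y := by gcongr; exact hA.trans hB
        _ = (2 * m) ^ p x y * max a b ^ p x y :=
          Real.mul_rpow (by linarith) (ha.trans (le_max_left _ _))
        _ ≤ (2 * m) ^ pM * (a ^ p x y + b ^ p x y) := by
          gcongr
          · linarith
          · exact (hb x y).2
          · rcases max_choice a b with h | h <;> rw [h]
            · linarith [Real.rpow_nonneg hb' (p x y)]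
            · linarith [Real.rpow_nonneg ha (p x y)]
    exact lintegral_lintegral_lt_top_of_le (measurable_gagliardo hpc hu.1)
      (measurable_gagliardo hpc hζm) ENNReal.ofReal_ne_top hu.2.2 hcut hpt

lemma abs_rpow_sub_two_mul {d p : ℝ} (hd : 0 ≤ d) (hp : 1 < p) :
    |d| ^ (p - 2) * d = d ^ (p - 1) := by
  rw [abs_of_nonneg hd]
  have := Real.rpow_add_one' hd (y := p - 2) (by linarith)
  rw [← this]; congr 1; ring

lemma abs_rpow_sub_two_mul_sub {a b V : ℝ} {p : ℝ} (hab : a ≤ b) (hp : 1 < p) :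
    |a - b| ^ (p - 2) * (a - b) * V = (b - a) ^ (p - 1) * -V := by
  rw [← abs_rpow_sub_two_mul (by linarith : 0 ≤ b - a) hp, abs_sub_comm]; ring

lemma remainder_le {p q δ W Z Y : ℝ} (hq : 0 ≤ q) (hδ : 0 ≤ δ) (hW : 0 ≤ W)
    (h : W ^ p ≤ Z + Y) :
    2 ^ (p - 1) * (q * δ * W) ^ p ≤ 2 ^ (p - 1) * (q * δ) ^ p * (Z + Y) := by
  rw [Real.mul_rpow (by positivity) hW, ← mul_assoc]
  gcongr

lemma near_lower {a b k m p q α β : ℝ} (hm : 0 ≤ m) (hp : 1 < p) (hpq : p ≤ q)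
    (hα : 0 ≤ α) (hα1 : α ≤ 1) (hβ : 0 ≤ β) (hβ1 : β ≤ 1) :
    0 ≤ 2 * (|a - b| ^ (p - 2) * (a - b) * (truncPos k m a * α ^ q - truncPos k m b * β ^ q))
      + (|a - b| ^ p
      + 2 * (2 ^ (p - 1) * (q * |α - β|) ^ p * (max (a - k) 0 ^ p + max (b - k) 0 ^ p))) := by
  have ha' : 0 ≤ max (a - k) 0 ^ p := Real.rpow_nonneg (le_max_right _ _) _
  have hb' : 0 ≤ max (b - k) 0 ^ p := Real.rpow_nonneg (le_max_right _ _) _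
  rcases le_total b a with h | h
  · have h1 := core_lower (k := k) h hm hp hpq hα hβ hβ1
    have h2 := remainder_le (p := p) (by linarith : 0 ≤ q) (abs_nonneg (α - β))
      (le_max_right (a - k) 0) (le_add_of_nonneg_right hb')
    rw [abs_rpow_sub_two_mul (by linarith : 0 ≤ a - b) hp, abs_of_nonneg (by linarith : 0 ≤ a - b)]
    linarith
  · have h1 := core_lower (k := k) h hm hp hpq hβ hα hα1
    have h2 := remainder_le (p := p) (by linarith : 0 ≤ q) (abs_nonneg (α - β))
      (le_max_right (b - k) 0) (le_add_of_nonneg_left ha')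
    rw [abs_rpow_sub_two_mul_sub h hp, abs_sub_comm a b, abs_of_nonneg (by linarith : 0 ≤ b - a)]
    rw [abs_sub_comm β α] at h1
    linarith

lemma near_coercive {a b k m p q α β : ℝ} (hp : 1 < p) (hpq : p ≤ q)
    (hα : 0 ≤ α) (hα1 : α ≤ 1) (hβ : 0 ≤ β) (hβ1 : β ≤ 1) (ham : max (a - k) 0 ≤ m)
    (hbm : max (b - k) 0 ≤ m) :
    |max (a - k) 0 - max (b - k) 0| ^ p * (α ^ q * β ^ q)
        + max (a - k) 0 * max (k - b) 0 ^ (p - 1) * α ^ q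
      ≤ 2 * (|a - b| ^ (p - 2) * (a - b) * (truncPos k m a * α ^ q - truncPos k m b * β ^ q))
        + 2 * (2 ^ (p - 1) * (q * |α - β|) ^ p * (max (a - k) 0 ^ p + max (b - k) 0 ^ p)) := by
  have ha' : 0 ≤ max (a - k) 0 ^ p := Real.rpow_nonneg (le_max_right _ _) _
  have hb' : 0 ≤ max (b - k) 0 ^ p := Real.rpow_nonneg (le_max_right _ _) _
  have hαq : α ^ q ≤ 1 := Real.rpow_le_one hα hα1 (by linarith)
  have hβq : β ^ q ≤ 1 := Real.rpow_le_one hβ hβ1 (by linarith)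
  have hα0 : 0 ≤ α ^ q := by positivity
  have hβ0 : 0 ≤ β ^ q := by positivity
  rcases le_total b a with h | h
  · have h1 := core_coercive h hp hpq hα hβ hβ1 ham
    have h2 := remainder_le (p := p) (by linarith : 0 ≤ q) (abs_nonneg (α - β))
      (le_max_right (a - k) 0) (le_add_of_nonneg_right hb')
    have h3 : 0 ≤ max (a - k) 0 - max (b - k) 0 := by
      have : max (b - k) 0 ≤ max (a - k) 0 := by gcongr
      linarith
    rw [abs_rpow_sub_two_mul (by linarith : 0 ≤ a - b) hp, abs_of_nonneg h3]
    have h4 := mul_le_mul_of_nonneg_left (mul_le_of_le_one_right hα0 hβq) (Real.rpow_nonneg h3 p)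
    linarith
  · have h1 := core_coercive h hp hpq hβ hα hα1 hbm
    have h2 := remainder_le (p := p) (by linarith : 0 ≤ q) (abs_nonneg (α - β))
      (le_max_right (b - k) 0) (le_add_of_nonneg_left ha')
    have h3 : 0 ≤ max (b - k) 0 - max (a - k) 0 := by
      have : max (a - k) 0 ≤ max (b - k) 0 := by gcongr
      linarith
    have h5 : max (a - k) 0 * max (k - b) 0 ^ (p - 1) = 0 := by
      rcases le_total a k with h' | h'
      · rw [max_eq_right (by linarith : a - k ≤ 0), zero_mul]
      · rw [max_eq_right (by linarith : k - b ≤ 0), Real.zero_rpow (by linarith), mul_zero]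
    have h6 : 0 ≤ max (b - k) 0 * max (k - a) 0 ^ (p - 1) * β ^ q :=
      mul_nonneg (mul_nonneg (le_max_right _ _) (Real.rpow_nonneg (le_max_right _ _) _)) hβ0
    rw [abs_rpow_sub_two_mul_sub h hp, h5, abs_sub_comm, abs_of_nonneg h3]
    rw [abs_sub_comm β α] at h1
    have h4 := mul_le_mul_of_nonneg_left (mul_le_of_le_one_left hβ0 hαq) (Real.rpow_nonneg h3 p)
    linarith

lemma far_lower {a b k m p ζ : ℝ} (hm : 0 ≤ m) (hp : 1 < p) (hζ : 0 ≤ ζ) (hζ1 : ζ ≤ 1) :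
    0 ≤ |a - b| ^ (p - 2) * (a - b) * (truncPos k m a * ζ)
      + max (a - k) 0 * max (b - k) 0 ^ (p - 1) := by
  have hv := truncPos_nonneg (k := k) hm a
  have hW : 0 ≤ max (a - k) 0 := le_max_right _ _
  have hZ : 0 ≤ max (b - k) 0 := le_max_right _ _
  have hvW := truncPos_le k m a
  rcases le_total b a with h | h
  · rw [abs_rpow_sub_two_mul (by linarith : 0 ≤ a - b) hp]
    have : 0 ≤ a - b := by linarith
    positivity
  · rw [abs_rpow_sub_two_mul_sub h hp]
    have hba : 0 ≤ b - a := by linarith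
    rcases le_total a k with h' | h'
    · have : truncPos k m a = 0 :=
        le_antisymm (hvW.trans (max_eq_right (by linarith)).le) hv
      rw [this]; simp only [zero_mul, neg_zero, mul_zero, zero_add]; positivity
    · have h1 : (b - a) ^ (p - 1) ≤ max (b - k) 0 ^ (p - 1) :=
        Real.rpow_le_rpow hba ((by linarith : b - a ≤ b - k).trans (le_max_left _ _)) (by linarith)
      have h2 : truncPos k m a * ζ ≤ max (a - k) 0 := (mul_le_of_le_one_right hv hζ1).trans hvW
      have h3 : (b - a) ^ (p - 1) * (truncPos k m a * ζ)
          ≤ max (b - k) 0 ^ (p - 1) * max (a - k) 0 := by gcongr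
      linarith

lemma ofReal_add_ofReal_neg_le {P F N : ℝ} (hP : 0 ≤ P) (hN : 0 ≤ N) (h : P ≤ F + N) :
    ENNReal.ofReal P + ENNReal.ofReal (-F) ≤ ENNReal.ofReal N + ENNReal.ofReal F := by
  rcases le_total 0 F with hF | hF
  · rw [ENNReal.ofReal_of_nonpos (by linarith : -F ≤ 0), add_zero, ← ENNReal.ofReal_add hN hF]
    exact ENNReal.ofReal_le_ofReal (by linarith)
  · rw [ENNReal.ofReal_of_nonpos hF, add_zero, ← ENNReal.ofReal_add hP (by linarith)]
    exact ENNReal.ofReal_le_ofReal (by linarith)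

lemma lintegral_le_lintegral_of_integral_nonpos {X : Type*} [MeasurableSpace X] {μ : Measure X}
    {F : X → ℝ} (hF : Integrable F μ) (h : ∫ z, F z ∂μ ≤ 0) {P N : X → ℝ≥0∞}
    (hle : ∀ z, P z + ENNReal.ofReal (-F z) ≤ N z + ENNReal.ofReal (F z)) :
    ∫⁻ z, P z ∂μ ≤ ∫⁻ z, N z ∂μ := by
  have hm : AEMeasurable (fun z => ENNReal.ofReal (F z)) μ := hF.aemeasurable.ennreal_ofReal
  have hm' : AEMeasurable (fun z => ENNReal.ofReal (-F z)) μ :=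
    hF.aemeasurable.neg.ennreal_ofReal
  have h1 := lintegral_mono (μ := μ) hle
  rw [lintegral_add_right' _ hm, lintegral_add_right' _ hm'] at h1
  have hn : ∫⁻ z, ENNReal.ofReal (-F z) ∂μ ≠ ⊤ := hF.neg.lintegral_lt_top.ne
  have hp : ∫⁻ z, ENNReal.ofReal (F z) ∂μ ≠ ⊤ := hF.lintegral_lt_top.ne
  rw [integral_eq_lintegral_pos_part_sub_lintegral_neg_part hF, sub_nonpos,
    ENNReal.toReal_le_toReal hp hn] at h
  exact (ENNReal.add_le_add_iff_right hn).1 (h1.trans (by gcongr))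

/-- The integrand of the weak formulation. -/
def energyDensity {n : ℕ} (s : ℝ) (p : Rn n → Rn n → ℝ) (u φ : Rn n → ℝ) (z : Rn n × Rn n) : ℝ :=
  |u z.1 - u z.2| ^ (p z.1 z.2 - 2) * (u z.1 - u z.2) * (φ z.1 - φ z.2)
    / ‖z.1 - z.2‖ ^ ((n : ℝ) + s * p z.1 z.2)

lemma energyDensity_swap {n : ℕ} {s : ℝ} {p : Rn n → Rn n → ℝ} (hp : ∀ x y, p x y = p y x)
    (u φ : Rn n → ℝ) (x y : Rn n) :
    energyDensity s p u φ (x, y) = energyDensity s p u φ (y, x) := by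
  simp only [energyDensity]
  rw [abs_sub_comm, hp x y, norm_sub_rev]; ring

lemma integrable_energyDensity {n : ℕ} {s : ℝ} {p : Rn n → Rn n → ℝ} (hp : ExponentOK p)
    {u φ : Rn n → ℝ} (hu : MemW s p u) (hφ : MemW s p φ) :
    Integrable (energyDensity s p u φ) := by
  obtain ⟨hpc, -, pm, pM, hpm, hb⟩ := hp
  have hum : Measurable fun z : Rn n × Rn n => u z.1 - u z.2 :=
    (hu.1.comp measurable_fst).sub (hu.1.comp measurable_snd)
  have hφm : Measurable fun z : Rn n × Rn n => φ z.1 - φ z.2 :=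
    (hφ.1.comp measurable_fst).sub (hφ.1.comp measurable_snd)
  have hum' : Measurable fun z : Rn n × Rn n => |u z.1 - u z.2| := hum.norm
  have hm : Measurable (energyDensity s p u φ) :=
    measurable_quotient hpc (((hum'.pow (hpc.measurable.sub_const 2)).mul hum).mul hφm)
  refine ⟨hm.aestronglyMeasurable, ?_⟩
  rw [HasFiniteIntegral, Measure.volume_eq_prod, lintegral_prod _ hm.enorm.aemeasurable]
  refine lintegral_lintegral_lt_top_of_le (c := ENNReal.ofReal (2 ^ pM))
    (measurable_gagliardo hpc hu.1)
    (measurable_gagliardo hpc hφ.1) ENNReal.ofReal_ne_top hu.2.2 hφ.2.2 fun x y => ?_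
  have hp1 : 1 < p x y := by linarith [(hb x y).1]
  rw [Real.enorm_eq_ofReal_abs, ← ENNReal.ofReal_mul (by positivity),
    ← ENNReal.ofReal_mul (by positivity), ← ENNReal.ofReal_add (by positivity) (by positivity)]
  apply ENNReal.ofReal_le_ofReal
  simp only [energyDensity]
  rw [abs_div, abs_of_nonneg (Real.rpow_nonneg (norm_nonneg _) _), mul_div_assoc', mul_div_assoc',
    ← add_div]
  gcongr
  rw [abs_mul, abs_mul, abs_of_nonneg (Real.rpow_nonneg (abs_nonneg _) _)]
  have e := abs_rpow_sub_two_mul (abs_nonneg (u x - u y)) hp1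
  rw [abs_abs] at e
  rw [e]
  refine (rpow_sub_one_mul_le (abs_nonneg _) (abs_nonneg _) hp1).trans ?_
  have h2 : (1 : ℝ) ≤ 2 ^ pM := Real.one_le_rpow (by norm_num) (by linarith [(hb x y).2])
  gcongr
  · linarith
  · norm_num
  · linarith [(hb x y).2]

lemma integral_energyDensity_nonpos {n : ℕ} {s : ℝ} {p : Rn n → Rn n → ℝ} (hp : ExponentOK p)
    {Ω : Set (Rn n)} {u φ : Rn n → ℝ} (hu : MemW s p u) (hsub : IsWeakSubsol s p Ω u)
    (hφ : MemW s p φ) (h0 : ∀ x, 0 ≤ φ x) (hΩ : ∀ x, x ∉ Ω → φ x = 0) :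
    ∫ z, energyDensity s p u φ z ≤ 0 := by
  rw [Measure.volume_eq_prod, integral_prod _ (integrable_energyDensity hp hu hφ)]
  exact hsub φ hφ h0 (Eventually.of_forall hΩ)

/-- A Lipschitz cutoff, equal to one on `ball x₀ r` and vanishing outside
`ball x₀ ((R + r) / 2)`. -/
def cutoff {n : ℕ} (x₀ : Rn n) (r R : ℝ) (x : Rn n) : ℝ :=
  max (min (((R + r) / 2 - ‖x - x₀‖) * (2 / (R - r))) 1) 0

section cutoff

variable {n : ℕ} {x₀ : Rn n} {r R : ℝ}

lemma cutoff_nonneg (x : Rn n) : 0 ≤ cutoff x₀ r R x := le_max_right _ _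

lemma cutoff_le_one (x : Rn n) : cutoff x₀ r R x ≤ 1 := max_le (min_le_right _ _) zero_le_one

lemma cutoff_eq_one (hr : r < R) {x : Rn n} (hx : x ∈ ball x₀ r) : cutoff x₀ r R x = 1 := by
  rw [mem_ball, dist_eq_norm] at hx
  have h : 0 < R - r := by linarith
  have : 1 ≤ ((R + r) / 2 - ‖x - x₀‖) * (2 / (R - r)) := by
    rw [mul_div_assoc', le_div_iff₀ h]; linarith
  rw [cutoff, min_eq_right this, max_eq_left zero_le_one]

lemma cutoff_eq_zero (hr : r < R) {x : Rn n} (hx : x ∉ ball x₀ ((R + r) / 2)) :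
    cutoff x₀ r R x = 0 := by
  rw [mem_ball, dist_eq_norm, not_lt] at hx
  have h : 0 < R - r := by linarith
  have : ((R + r) / 2 - ‖x - x₀‖) * (2 / (R - r)) ≤ 0 :=
    mul_nonpos_of_nonpos_of_nonneg (by linarith) (by positivity)
  rw [cutoff, max_eq_right ((min_le_left _ _).trans this)]

lemma abs_cutoff_sub_le (hr : r < R) (x y : Rn n) :
    |cutoff x₀ r R x - cutoff x₀ r R y| ≤ 2 / (R - r) * ‖x - y‖ := by
  have h : 0 < R - r := by linarith
  unfold cutoff
  refine (abs_max_sub_max_le_max _ _ _ _).trans ?_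
  rw [sub_self, abs_zero]
  refine max_le ?_ (by positivity)
  refine (abs_min_sub_min_le_max _ _ _ _).trans ?_
  rw [sub_self, abs_zero]
  refine max_le ?_ (by positivity)
  rw [← sub_mul, abs_mul, abs_of_pos (by positivity : 0 < 2 / (R - r)), mul_comm]
  gcongr
  rw [sub_sub_sub_cancel_left]
  exact (abs_norm_sub_norm_le (y - x₀) (x - x₀)).trans_eq
    (by rw [sub_sub_sub_cancel_right, norm_sub_rev])

lemma measurable_cutoff : Measurable (cutoff x₀ r R) := by
  unfold cutoff
  have : Measurable fun x : Rn n => ‖x - x₀‖ := (measurable_id.sub_const x₀).norm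
  exact (((this.const_sub _).mul_const _).min measurable_const).max measurable_const

lemma abs_rpow_sub_rpow_le {α β q : ℝ} (hα : 0 ≤ α) (hα1 : α ≤ 1) (hβ : 0 ≤ β) (hβ1 : β ≤ 1)
    (hq : 1 ≤ q) : |α ^ q - β ^ q| ≤ q * |α - β| := by
  wlog h : α ≤ β generalizing α β
  · rw [abs_sub_comm, abs_sub_comm α]
    exact this hβ hβ1 hα hα1 (le_of_not_ge h)
  · have h1 : α ^ q ≤ β ^ q := by gcongr
    rw [abs_sub_comm, abs_sub_comm α, abs_of_nonneg (by linarith), abs_of_nonneg (by linarith)]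
    have h2 : 0 ≤ q * (β - α) := mul_nonneg (by linarith) (by linarith)
    exact (rpow_sub_rpow_le hα h hq).trans
      (mul_le_of_le_one_right h2 (Real.rpow_le_one hβ hβ1 (by linarith)))

end cutoff

lemma remainder_div_le {ν s p q δ W ρ t : ℝ} (hp : 1 < p) (hpq : p ≤ q) (hδ : 0 ≤ δ)
    (hW : 0 ≤ W) (hρ : 0 < ρ) (ht : 0 ≤ t) (hδt : δ ≤ 2 / ρ * t) :
    2 * (2 ^ (p - 1) * (q * δ) ^ p * W ^ p) / t ^ (ν + s * p)
      ≤ (4 * q) ^ q * ((W / ρ) ^ p / t ^ (ν - (1 - s) * p)) := by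
  have hq : 0 < q := by linarith
  rcases ht.eq_or_lt with rfl | ht
  · have : δ = 0 := by linarith
    rw [this, mul_zero, Real.zero_rpow (by linarith)]
    simp only [mul_zero, zero_mul, zero_div]
    positivity
  · have e1 : (2 : ℝ) * 2 ^ (p - 1) = 2 ^ p := by
      rw [mul_comm, rpow_sub_one_mul_self (by norm_num) hp]
    have h1 : (q * δ) ^ p ≤ (q * (2 / ρ * t)) ^ p := by gcongr
    have e2 : 2 ^ p * (q * (2 / ρ * t)) ^ p * W ^ p = (4 * q) ^ p * ((W / ρ) ^ p * t ^ p) := by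
      rw [← Real.mul_rpow (by norm_num) (by positivity), ← Real.mul_rpow (by positivity) hW,
        ← Real.mul_rpow (by positivity) ht.le, ← Real.mul_rpow (by positivity) (by positivity)]
      congr 1; field_simp; ring
    have e3 : t ^ p / t ^ (ν + s * p) = (t ^ (ν - (1 - s) * p))⁻¹ := by
      rw [← Real.rpow_sub ht, ← Real.rpow_neg ht.le]; congr 1; ring
    calc 2 * (2 ^ (p - 1) * (q * δ) ^ p * W ^ p) / t ^ (ν + s * p)
        = 2 ^ p * (q * δ) ^ p * W ^ p / t ^ (ν + s * p) := by rw [← e1]; ring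
      _ ≤ 2 ^ p * (q * (2 / ρ * t)) ^ p * W ^ p / t ^ (ν + s * p) := by gcongr
      _ = (4 * q) ^ p * ((W / ρ) ^ p / t ^ (ν - (1 - s) * p)) := by
        rw [e2, mul_div_assoc, mul_div_assoc, e3, ← div_eq_mul_inv]
      _ ≤ _ := by
        gcongr
        linarith

lemma norm_kernel_le {n : ℕ} {x₀ x y : Rn n} {r R e : ℝ} (hr0 : 0 < r) (hr : r < R) (he : 0 ≤ e)
    (hx : x ∈ ball x₀ ((R + r) / 2)) (hy : y ∉ ball x₀ R) :
    1 / ‖x - y‖ ^ e ≤ 1 / ‖y - x₀‖ ^ e * (2 * R / (R - r)) ^ e := by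
  rw [mem_ball, dist_eq_norm] at hx
  rw [mem_ball, dist_eq_norm, not_lt] at hy
  have hρ : 0 < R - r := by linarith
  have hR : 0 < R := by linarith
  have h1 : ‖y - x₀‖ ≤ ‖x - y‖ + ‖x - x₀‖ := by
    rw [norm_sub_rev x y]
    exact (congrArg norm (sub_add_sub_cancel y x x₀)).symm.le.trans (norm_add_le _ _)
  have hxy : 0 < ‖x - y‖ := by linarith
  have hy0 : 0 < ‖y - x₀‖ := by linarith
  have h2 : ‖y - x₀‖ ≤ ‖x - y‖ * (2 * R / (R - r)) := by
    rw [mul_div_assoc', le_div_iff₀ hρ]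
    nlinarith
  have h3 : ‖y - x₀‖ ^ e ≤ ‖x - y‖ ^ e * (2 * R / (R - r)) ^ e := by
    rw [← Real.mul_rpow hxy.le (by positivity)]
    gcongr
  rw [one_div_mul_eq_div, div_le_div_iff₀ (by positivity) (by positivity)]
  linarith

/-- The density whose integral is the left-hand side of the Caccioppoli inequality. -/
def caccioppoliDensity {n : ℕ} (s : ℝ) (p : Rn n → Rn n → ℝ) (u : Rn n → ℝ) (k : ℝ) (x₀ : Rn n)
    (r R : ℝ) (z : Rn n × Rn n) : ℝ≥0∞ :=
  (ball x₀ r ×ˢ ball x₀ r).indicator (fun z => ENNReal.ofReal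
      (|max (u z.1 - k) 0 - max (u z.2 - k) 0| ^ p z.1 z.2
        / ‖z.1 - z.2‖ ^ ((n : ℝ) + s * p z.1 z.2))) z
    + (ball x₀ r ×ˢ ball x₀ R).indicator (fun z => ENNReal.ofReal (max (u z.1 - k) 0) *
      ENNReal.ofReal ((max (k - u z.2) 0) ^ (p z.1 z.2 - 1)
        / ‖z.1 - z.2‖ ^ ((n : ℝ) + s * p z.1 z.2))) z

/-- The density of the local term on the right-hand side. -/
def localDensity {n : ℕ} (s : ℝ) (p : Rn n → Rn n → ℝ) (u : Rn n → ℝ) (k r R : ℝ)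
    (z : Rn n × Rn n) : ℝ≥0∞ :=
  ENNReal.ofReal ((max (u z.1 - k) 0 / (R - r)) ^ p z.1 z.2
    / ‖z.1 - z.2‖ ^ ((n : ℝ) - (1 - s) * p z.1 z.2))

/-- The density of the nonlocal tail. -/
def tailDensity {n : ℕ} (s : ℝ) (p : Rn n → Rn n → ℝ) (u : Rn n → ℝ) (k : ℝ) (x₀ : Rn n)
    (r R : ℝ) (z : Rn n × Rn n) : ℝ≥0∞ :=
  ENNReal.ofReal ((max (u z.2 - k) 0) ^ (p z.1 z.2 - 1)
    / ‖z.2 - x₀‖ ^ ((n : ℝ) + s * p z.1 z.2) * (2 * R / (R - r)) ^ ((n : ℝ) + s * p z.1 z.2))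

/-- The pairs at which `(u - k)₊` stays below the truncation level. -/
def belowLevel {n : ℕ} (u : Rn n → ℝ) (k m : ℝ) : Set (Rn n × Rn n) :=
  {z | max (u z.1 - k) 0 ≤ m ∧ max (u z.2 - k) 0 ≤ m}

/-- The truncated test function. -/
def testFun {n : ℕ} (u : Rn n → ℝ) (k m q : ℝ) (x₀ : Rn n) (r R : ℝ) (x : Rn n) : ℝ :=
  truncPos k m (u x) * cutoff x₀ r R x ^ q

section pointwise

variable {n : ℕ} {s : ℝ} {p : Rn n → Rn n → ℝ} {u : Rn n → ℝ} {k m q : ℝ} {x₀ : Rn n} {r R : ℝ}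

lemma testFun_eq_zero (hq : 1 < q) (hr : r < R) {x : Rn n} (hx : x ∉ ball x₀ ((R + r) / 2)) :
    testFun u k m q x₀ r R x = 0 := by
  rw [testFun, cutoff_eq_zero hr hx, Real.zero_rpow (by linarith), mul_zero]

lemma ball_mid_subset (hr : r < R) : ball x₀ ((R + r) / 2) ⊆ ball x₀ R :=
  ball_subset_ball (by linarith)

lemma caccioppoliDensity_le_near (hr : r < R) (x y : Rn n) :
    caccioppoliDensity s p u k x₀ r R (x, y)
      ≤ ENNReal.ofReal ((|max (u x - k) 0 - max (u y - k) 0| ^ p x y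
            * (cutoff x₀ r R x ^ q * cutoff x₀ r R y ^ q)
          + max (u x - k) 0 * max (k - u y) 0 ^ (p x y - 1) * cutoff x₀ r R x ^ q)
          / ‖x - y‖ ^ ((n : ℝ) + s * p x y)) := by
  have hc := cutoff_nonneg (x₀ := x₀) (r := r) (R := R)
  have hcq : ∀ x, 0 ≤ cutoff x₀ r R x ^ q := fun x => Real.rpow_nonneg (hc x) q
  have hK : 0 ≤ ‖x - y‖ ^ ((n : ℝ) + s * p x y) := by positivity
  have hW : 0 ≤ max (u x - k) 0 := le_max_right _ _
  have hZ : 0 ≤ max (k - u y) 0 := le_max_right _ _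
  have hcx := hcq x
  have hcy := hcq y
  rw [add_div, ENNReal.ofReal_add (by positivity) (by positivity), caccioppoliDensity]
  refine add_le_add (indicator_apply_le' (fun hz => ?_) fun _ => zero_le)
    (indicator_apply_le' (fun hz => ?_) fun _ => zero_le)
  · rw [cutoff_eq_one hr (mem_prod.1 hz).1, cutoff_eq_one hr (mem_prod.1 hz).2]
    simp
  · rw [cutoff_eq_one hr (mem_prod.1 hz).1, ← ENNReal.ofReal_mul hW]
    simp [mul_div_assoc]

lemma remainder_ofReal_le (hr : r < R) {x y : Rn n} (hp : 1 < p x y)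
    (hsymm : p x y = p y x) (hpq : p x y ≤ q) :
    ENNReal.ofReal (2 * (2 ^ (p x y - 1) * (q * |cutoff x₀ r R x - cutoff x₀ r R y|) ^ p x y
        * (max (u x - k) 0 ^ p x y + max (u y - k) 0 ^ p x y))
        / ‖x - y‖ ^ ((n : ℝ) + s * p x y))
      ≤ ENNReal.ofReal ((4 * q) ^ q)
        * (localDensity s p u k r R (x, y) + localDensity s p u k r R (y, x)) := by
  have hρ : 0 < R - r := by linarith
  have hq : 0 < q := by linarith
  have hW : ∀ x, 0 ≤ max (u x - k) 0 := fun x => le_max_right _ _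
  have h1 := fun w hw => remainder_div_le (ν := n) (s := s) (W := w) hp hpq
    (abs_nonneg (cutoff x₀ r R x - cutoff x₀ r R y)) hw hρ (norm_nonneg (x - y))
    (abs_cutoff_sub_le hr x y)
  have hWx := hW x
  have hWy := hW y
  simp only [localDensity]
  rw [← hsymm, norm_sub_rev y x, ← ENNReal.ofReal_add (by positivity) (by positivity),
    ← ENNReal.ofReal_mul (by positivity)]
  apply ENNReal.ofReal_le_ofReal
  have := add_le_add (h1 _ hWx) (h1 _ hWy)
  rw [mul_add ((4 * q) ^ q)]
  refine le_trans (le_of_eq ?_) this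
  ring

/-- Pointwise bound for pairs in the large ball. -/
lemma near_pointwise (hr : r < R) (hm : 0 ≤ m) {x y : Rn n}
    (hp : 1 < p x y) (hsymm : p x y = p y x) (hpq : p x y ≤ q) :
    (belowLevel u k m).indicator (caccioppoliDensity s p u k x₀ r R) (x, y)
      + ENNReal.ofReal (-(2 * energyDensity s p u (testFun u k m q x₀ r R) (x, y)))
    ≤ (belowLevel u k m)ᶜ.indicator (fun z => ENNReal.ofReal (|u z.1 - u z.2| ^ p z.1 z.2
          / ‖z.1 - z.2‖ ^ ((n : ℝ) + s * p z.1 z.2))) (x, y)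
      + ENNReal.ofReal ((4 * q) ^ q)
        * (localDensity s p u k r R (x, y) + localDensity s p u k r R (y, x))
      + ENNReal.ofReal (2 * energyDensity s p u (testFun u k m q x₀ r R) (x, y)) := by
  have hrem := remainder_ofReal_le (u := u) (k := k) (x₀ := x₀) (s := s) hr hp hsymm hpq
  have hc := cutoff_nonneg (x₀ := x₀) (r := r) (R := R)
  have hc1 := cutoff_le_one (x₀ := x₀) (r := r) (R := R)
  have hK : 0 ≤ ‖x - y‖ ^ ((n : ℝ) + s * p x y) := by positivity
  have hWx : 0 ≤ max (u x - k) 0 := le_max_right _ _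
  have hWy : 0 ≤ max (u y - k) 0 := le_max_right _ _
  have hZ : 0 ≤ max (k - u y) 0 := le_max_right _ _
  have hcx : 0 ≤ cutoff x₀ r R x ^ q := Real.rpow_nonneg (hc x) q
  have hcy : 0 ≤ cutoff x₀ r R y ^ q := Real.rpow_nonneg (hc y) q
  have hq : 0 < q := by linarith
  by_cases hz : (x, y) ∈ belowLevel u k m
  · rw [indicator_of_mem hz, indicator_of_notMem (by simpa using hz), zero_add]
    refine (add_le_add_left (caccioppoliDensity_le_near (q := q) hr x y) _).trans ?_
    refine le_trans ?_ (add_le_add_left hrem _)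
    apply ofReal_add_ofReal_neg_le (by positivity) (by positivity)
    have := near_coercive hp hpq (hc x) (hc1 x) (hc y) (hc1 y) hz.1 hz.2
    simp only [energyDensity, testFun]
    rw [mul_div_assoc', ← add_div]
    gcongr
  · rw [indicator_of_notMem hz, indicator_of_mem (by simpa using hz)]
    refine le_trans ?_ (add_le_add_left (add_le_add_right hrem _) _)
    rw [← ENNReal.ofReal_add (by positivity) (by positivity), ← ENNReal.ofReal_zero]
    apply ofReal_add_ofReal_neg_le le_rfl (by positivity)
    have := near_lower (k := k) (a := u x) (b := u y) hm hp hpq (hc x) (hc1 x) (hc y) (hc1 y)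
    simp only [energyDensity, testFun]
    rw [mul_div_assoc', ← add_div, ← add_div]
    exact div_nonneg this hK

/-- Pointwise bound for pairs with one point outside the large ball. -/
lemma far_pointwise (hs : s ∈ Ioo (0 : ℝ) 1) (hr0 : 0 < r) (hr : r < R) (hm : 0 ≤ m) (hq : 1 < q)
    {x y : Rn n} (hp : 1 < p x y) (hy : y ∉ ball x₀ R) :
    ENNReal.ofReal (-(2 * energyDensity s p u (testFun u k m q x₀ r R) (x, y)))
    ≤ 2 * (ball x₀ ((R + r) / 2) ×ˢ (ball x₀ R)ᶜ).indicator (fun z =>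
        ENNReal.ofReal (max (u z.1 - k) 0) * tailDensity s p u k x₀ r R z) (x, y) := by
  have hty : testFun u k m q x₀ r R y = 0 :=
    testFun_eq_zero hq hr fun h => hy (ball_mid_subset hr h)
  by_cases hx : x ∈ ball x₀ ((R + r) / 2)
  · rw [indicator_of_mem (mk_mem_prod hx hy), tailDensity]
    have hWx : 0 ≤ max (u x - k) 0 := le_max_right _ _
    have hWy : 0 ≤ max (u y - k) 0 := le_max_right _ _
    have hc := cutoff_nonneg (x₀ := x₀) (r := r) (R := R) x
    have h2 : ∀ t : ℝ, 2 * ENNReal.ofReal t = ENNReal.ofReal (2 * t) := fun t => by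
      rw [ENNReal.ofReal_mul (by norm_num), ENNReal.ofReal_ofNat]
    rw [← ENNReal.ofReal_mul hWx, h2]
    apply ENNReal.ofReal_le_ofReal
    have hfar := far_lower (k := k) (a := u x) (b := u y) hm hp (Real.rpow_nonneg hc q)
      (Real.rpow_le_one hc (cutoff_le_one x) (by linarith))
    have he : 0 ≤ (n : ℝ) + s * p x y := by have := hs.1; positivity
    have hk := mul_le_mul_of_nonneg_left (norm_kernel_le hr0 hr he hx hy)
      (by positivity : 0 ≤ max (u x - k) 0 * max (u y - k) 0 ^ (p x y - 1))
    have h1 := div_nonneg hfar (Real.rpow_nonneg (norm_nonneg (x - y)) ((n : ℝ) + s * p x y))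
    rw [add_div] at h1
    simp only [energyDensity]
    rw [hty, sub_zero, testFun]
    have e : max (u x - k) 0 * (max (u y - k) 0 ^ (p x y - 1) / ‖y - x₀‖ ^ ((n : ℝ) + s * p x y)
        * (2 * R / (R - r)) ^ ((n : ℝ) + s * p x y))
      = max (u x - k) 0 * max (u y - k) 0 ^ (p x y - 1) * (1 / ‖y - x₀‖ ^ ((n : ℝ) + s * p x y)
        * (2 * R / (R - r)) ^ ((n : ℝ) + s * p x y)) := by ring
    rw [e]
    rw [mul_one_div] at hk
    linarith
  · simp [energyDensity, hty, testFun_eq_zero hq hr hx]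

/-- The pointwise inequality obtained from the truncated test function. -/
lemma pointwise_bound (hs : s ∈ Ioo (0 : ℝ) 1) (hr0 : 0 < r) (hr : r < R) (hm : 0 ≤ m)
    (hq : 1 < q) (hp : ∀ x y, 1 < p x y) (hsymm : ∀ x y, p x y = p y x)
    (hpq : ∀ x ∈ ball x₀ R, ∀ y ∈ ball x₀ R, p x y ≤ q) (z : Rn n × Rn n) :
    (belowLevel u k m).indicator (caccioppoliDensity s p u k x₀ r R) z
      + ENNReal.ofReal (-(2 * energyDensity s p u (testFun u k m q x₀ r R) z))
    ≤ ((belowLevel u k m)ᶜ.indicator (fun z => ENNReal.ofReal (|u z.1 - u z.2| ^ p z.1 z.2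
          / ‖z.1 - z.2‖ ^ ((n : ℝ) + s * p z.1 z.2))) z
      + ENNReal.ofReal ((4 * q) ^ q)
        * ((ball x₀ R ×ˢ ball x₀ R).indicator (localDensity s p u k r R) z
          + (ball x₀ R ×ˢ ball x₀ R).indicator (localDensity s p u k r R) z.swap)
      + 2 * ((ball x₀ ((R + r) / 2) ×ˢ (ball x₀ R)ᶜ).indicator (fun z =>
        ENNReal.ofReal (max (u z.1 - k) 0) * tailDensity s p u k x₀ r R z) z
        + (ball x₀ ((R + r) / 2) ×ˢ (ball x₀ R)ᶜ).indicator (fun z =>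
        ENNReal.ofReal (max (u z.1 - k) 0) * tailDensity s p u k x₀ r R z) z.swap))
      + ENNReal.ofReal (2 * energyDensity s p u (testFun u k m q x₀ r R) z) := by
  obtain ⟨x, y⟩ := z
  have hsub : ball x₀ r ⊆ ball x₀ R := ball_subset_ball hr.le
  have hzero : ¬ (x ∈ ball x₀ R ∧ y ∈ ball x₀ R) →
      (belowLevel u k m).indicator (caccioppoliDensity s p u k x₀ r R) (x, y) = 0 := by
    intro h
    refine indicator_apply_eq_zero.2 fun _ => ?_
    rw [caccioppoliDensity, indicator_of_notMem, indicator_of_notMem, add_zero]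
    · exact fun hz => h ⟨hsub hz.1, hz.2⟩
    · exact fun hz => h ⟨hsub hz.1, hsub hz.2⟩
  by_cases hx : x ∈ ball x₀ R <;> by_cases hy : y ∈ ball x₀ R
  · refine (near_pointwise hr hm (hp x y) (hsymm x y) (hpq x hx y hy)).trans ?_
    rw [Prod.swap_prod_mk, indicator_of_mem (mk_mem_prod hx hy),
      indicator_of_mem (mk_mem_prod hy hx)]
    exact add_le_add_left le_self_add _
  · rw [hzero fun h => hy h.2, zero_add]
    refine (far_pointwise hs hr0 hr hm hq (hp x y) hy).trans ?_
    rw [mul_add 2]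
    exact (le_self_add.trans le_add_self).trans le_self_add
  · rw [hzero fun h => hx h.1, zero_add, energyDensity_swap hsymm]
    refine (far_pointwise hs hr0 hr hm hq (hp y x) hx).trans ?_
    rw [mul_add 2]
    exact (le_add_self.trans le_add_self).trans le_self_add
  · rw [hzero fun h => hx h.1, zero_add]
    refine (far_pointwise hs hr0 hr hm hq (hp x y) hy).trans ?_
    rw [mul_add 2]
    exact (le_self_add.trans le_add_self).trans le_self_add

end pointwise

section integrated

variable {n : ℕ} {s : ℝ} {p : Rn n → Rn n → ℝ} {u : Rn n → ℝ} {k m q : ℝ} {x₀ : Rn n} {r R : ℝ}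

lemma measurable_posPart_comp (hu : Measurable u) : Measurable fun x => max (u x - k) 0 :=
  (hu.sub_const k).max measurable_const

lemma measurable_bulkDensity (hpc : Continuous fun z : Rn n × Rn n => p z.1 z.2)
    (hu : Measurable u) : Measurable fun z : Rn n × Rn n => ENNReal.ofReal (max (u z.1 - k) 0) *
      ENNReal.ofReal ((max (k - u z.2) 0) ^ (p z.1 z.2 - 1)
        / ‖z.1 - z.2‖ ^ ((n : ℝ) + s * p z.1 z.2)) := by
  have h1 : Measurable fun z : Rn n × Rn n => max (k - u z.2) 0 :=
    ((hu.const_sub k).max measurable_const).comp measurable_snd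
  exact ((measurable_posPart_comp hu).comp measurable_fst).ennreal_ofReal.mul
    (measurable_quotient hpc (h1.pow (hpc.measurable.sub_const 1))).ennreal_ofReal

lemma measurable_caccioppoliDensity (hpc : Continuous fun z : Rn n × Rn n => p z.1 z.2)
    (hu : Measurable u) : Measurable (caccioppoliDensity s p u k x₀ r R) :=
  ((measurable_gagliardo hpc (measurable_posPart_comp hu)).indicator
      (measurableSet_ball.prod measurableSet_ball)).add
    ((measurable_bulkDensity hpc hu).indicator (measurableSet_ball.prod measurableSet_ball))

lemma measurable_localDensity (hpc : Continuous fun z : Rn n × Rn n => p z.1 z.2)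
    (hu : Measurable u) : Measurable (localDensity s p u k r R) := by
  have h1 : Measurable fun z : Rn n × Rn n => max (u z.1 - k) 0 / (R - r) :=
    ((measurable_posPart_comp hu).comp measurable_fst).div_const _
  exact ((h1.pow hpc.measurable).div ((measurable_fst.sub measurable_snd).norm.pow
    ((hpc.measurable.const_mul (1 - s)).const_sub (n : ℝ)))).ennreal_ofReal

lemma measurable_tailDensity (hpc : Continuous fun z : Rn n × Rn n => p z.1 z.2)
    (hu : Measurable u) : Measurable (tailDensity s p u k x₀ r R) := by
  have h1 : Measurable fun z : Rn n × Rn n => max (u z.2 - k) 0 :=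
    (measurable_posPart_comp hu).comp measurable_snd
  have h2 : Measurable fun z : Rn n × Rn n => ‖z.2 - x₀‖ := (measurable_snd.sub_const x₀).norm
  have h3 : Measurable fun z : Rn n × Rn n => (n : ℝ) + s * p z.1 z.2 :=
    (hpc.measurable.const_mul s).const_add _
  exact (((h1.pow (hpc.measurable.sub_const 1)).div (h2.pow h3)).mul
    (measurable_const.pow h3)).ennreal_ofReal

lemma measurableSet_belowLevel (hu : Measurable u) : MeasurableSet (belowLevel u k m) :=
  (measurableSet_le ((measurable_posPart_comp hu).comp measurable_fst) measurable_const).inter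
    (measurableSet_le ((measurable_posPart_comp hu).comp measurable_snd) measurable_const)

lemma lintegral_caccioppoliDensity (hpc : Continuous fun z : Rn n × Rn n => p z.1 z.2)
    (hu : Measurable u) :
    ∫⁻ z, caccioppoliDensity s p u k x₀ r R z =
      (∫⁻ x in ball x₀ r, ∫⁻ y in ball x₀ r,
          ENNReal.ofReal (|max (u x - k) 0 - max (u y - k) 0| ^ p x y
            / ‖x - y‖ ^ ((n : ℝ) + s * p x y))) +
      (∫⁻ x in ball x₀ r, ENNReal.ofReal (max (u x - k) 0) *
          ∫⁻ y in ball x₀ R,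
            ENNReal.ofReal ((max (k - u y) 0) ^ (p x y - 1)
              / ‖x - y‖ ^ ((n : ℝ) + s * p x y))) := by
  have h1 := measurable_gagliardo (s := s) hpc (measurable_posPart_comp (k := k) hu)
  have h2 := measurable_bulkDensity (s := s) (k := k) hpc hu
  unfold caccioppoliDensity
  rw [lintegral_add_left (h1.indicator (measurableSet_ball.prod measurableSet_ball)),
    lintegral_indicator (measurableSet_ball.prod measurableSet_ball),
    lintegral_indicator (measurableSet_ball.prod measurableSet_ball), Measure.volume_eq_prod,
    setLIntegral_prod _ h1.aemeasurable, setLIntegral_prod _ h2.aemeasurable]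
  congr 1
  refine lintegral_congr fun x => ?_
  dsimp only
  exact lintegral_const_mul' _ _ ENNReal.ofReal_ne_top

lemma lintegral_tail_le (hpc : Continuous fun z : Rn n × Rn n => p z.1 z.2)
    (hu : Measurable u) (hr : r < R) :
    ∫⁻ z, (ball x₀ ((R + r) / 2) ×ˢ (ball x₀ R)ᶜ).indicator (fun z =>
        ENNReal.ofReal (max (u z.1 - k) 0) * tailDensity s p u k x₀ r R z) z
      ≤ (⨆ x ∈ ball x₀ ((R + r) / 2), ∫⁻ y in (ball x₀ R)ᶜ, tailDensity s p u k x₀ r R (x, y)) *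
          (∫⁻ x in ball x₀ R, ENNReal.ofReal (max (u x - k) 0)) := by
  have hw : Measurable fun x => ENNReal.ofReal (max (u x - k) 0) :=
    (measurable_posPart_comp hu).ennreal_ofReal
  have h1 : Measurable fun z : Rn n × Rn n =>
      ENNReal.ofReal (max (u z.1 - k) 0) * tailDensity s p u k x₀ r R z :=
    (hw.comp measurable_fst).mul (measurable_tailDensity hpc hu)
  set S := ⨆ x ∈ ball x₀ ((R + r) / 2), ∫⁻ y in (ball x₀ R)ᶜ, tailDensity s p u k x₀ r R (x, y)
  rw [lintegral_indicator (measurableSet_ball.prod measurableSet_ball.compl),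
    Measure.volume_eq_prod, setLIntegral_prod _ h1.aemeasurable]
  calc _ ≤ ∫⁻ x in ball x₀ ((R + r) / 2), S * ENNReal.ofReal (max (u x - k) 0) := by
        refine setLIntegral_mono (hw.const_mul S) fun x hx => ?_
        dsimp only
        rw [lintegral_const_mul' _ _ ENNReal.ofReal_ne_top, mul_comm]
        gcongr
        exact le_iSup₂ (f := fun x (_ : x ∈ ball x₀ ((R + r) / 2)) =>
          ∫⁻ y in (ball x₀ R)ᶜ, tailDensity s p u k x₀ r R (x, y)) x hx
    _ = S * ∫⁻ x in ball x₀ ((R + r) / 2), ENNReal.ofReal (max (u x - k) 0) :=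
        lintegral_const_mul _ hw
    _ ≤ _ := by
        gcongr
        linarith

lemma memW_testFun (hn : 1 ≤ n) (hs : s ∈ Ioo (0 : ℝ) 1) (hp : ExponentOK p) (hu : MemW s p u)
    (hm : 1 ≤ m) (hq : 1 < q) (hr : r < R) : MemW s p (testFun u k m q x₀ r R) := by
  have hc := cutoff_nonneg (x₀ := x₀) (r := r) (R := R)
  have hc1 := cutoff_le_one (x₀ := x₀) (r := r) (R := R)
  have hρ : 0 < R - r := by linarith
  have hL : 0 ≤ q * (2 / (R - r)) := by positivity
  refine memW_truncPos_mul hn hs hp hu hm (measurable_cutoff.pow_const q)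
    (fun x => Real.rpow_nonneg (hc x) q) (fun x => Real.rpow_le_one (hc x) (hc1 x) (by linarith))
    (le_add_of_nonneg_right hL) (fun x y => ?_) (x₀ := x₀) (R := R) (fun x hx => ?_)
  · have h1 := abs_rpow_sub_rpow_le (hc x) (hc1 x) (hc y) (hc1 y) hq.le
    have h2 := mul_le_mul_of_nonneg_left (abs_cutoff_sub_le (x₀ := x₀) hr x y)
      (by linarith : 0 ≤ q)
    nlinarith [norm_nonneg (x - y)]
  · rw [cutoff_eq_zero hr fun h => hx (ball_mid_subset hr h), Real.zero_rpow (by linarith)]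

lemma lintegral_add_symmetrized {X : Type*} [MeasureSpace X] [SFinite (volume : Measure X)]
    {g f h : X × X → ℝ≥0∞} (c : ℝ≥0∞) (hg : Measurable g) (hf : Measurable f) (hh : Measurable h) :
    ∫⁻ z, (g z + c * (f z + f z.swap) + 2 * (h z + h z.swap)) =
      (∫⁻ z, g z) + c * ((∫⁻ z, f z) + ∫⁻ z, f z) + 2 * ((∫⁻ z, h z) + ∫⁻ z, h z) := by
  have hswap : ∀ f : X × X → ℝ≥0∞, ∫⁻ z : X × X, f z.swap = ∫⁻ z, f z := fun f => by
    rw [Measure.volume_eq_prod]; exact lintegral_prod_swap f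
  have hf' : Measurable fun z : X × X => f z + f z.swap := hf.add (hf.comp measurable_swap)
  have hh' : Measurable fun z : X × X => h z + h z.swap := hh.add (hh.comp measurable_swap)
  rw [lintegral_add_right _ (hh'.const_mul 2), lintegral_add_left hg, lintegral_const_mul _ hf',
    lintegral_const_mul _ hh', lintegral_add_left hf, lintegral_add_left hh, hswap, hswap]

/-- The Caccioppoli inequality below a truncation level, up to an error supported above it. -/
lemma caccioppoli_belowLevel (hn : 1 ≤ n) (hs : s ∈ Ioo (0 : ℝ) 1) (hp : ExponentOK p)
    {Ω : Set (Rn n)} (hu : MemW s p u) (hsub : IsWeakSubsol s p Ω u) (hr0 : 0 < r) (hr : r < R)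
    (hΩ : ball x₀ R ⊆ Ω) (hm : 1 ≤ m) (hq : 1 < q)
    (hpq : ∀ x ∈ ball x₀ R, ∀ y ∈ ball x₀ R, p x y ≤ q) :
    ∫⁻ z, (belowLevel u k m).indicator (caccioppoliDensity s p u k x₀ r R) z
      ≤ (∫⁻ z, (belowLevel u k m)ᶜ.indicator (fun z => ENNReal.ofReal (|u z.1 - u z.2| ^ p z.1 z.2
          / ‖z.1 - z.2‖ ^ ((n : ℝ) + s * p z.1 z.2))) z)
        + (ENNReal.ofReal (4 + 2 * (4 * q) ^ q) *
            (∫⁻ x in ball x₀ R, ∫⁻ y in ball x₀ R, localDensity s p u k r R (x, y))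
          + ENNReal.ofReal (4 + 2 * (4 * q) ^ q) *
            (⨆ x ∈ ball x₀ ((R + r) / 2),
              ∫⁻ y in (ball x₀ R)ᶜ, tailDensity s p u k x₀ r R (x, y)) *
            (∫⁻ x in ball x₀ R, ENNReal.ofReal (max (u x - k) 0))) := by
  have hφ := memW_testFun (k := k) (x₀ := x₀) hn hs hp hu hm hq hr
  have hF := integrable_energyDensity hp hu hφ
  have hF0 := integral_energyDensity_nonpos hp hu hsub hφ
    (fun x => mul_nonneg (truncPos_nonneg (by linarith) _) (Real.rpow_nonneg (cutoff_nonneg x) q))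
    (fun x hx => testFun_eq_zero hq hr fun h => hx (hΩ (ball_mid_subset hr h)))
  obtain ⟨hpc, hsymm, pm, pM, hpm, hb⟩ := hp
  have hp1 : ∀ x y, 1 < p x y := fun x y => by linarith [(hb x y).1]
  have hmain := lintegral_le_lintegral_of_integral_nonpos (hF.const_mul 2)
    (by rw [integral_const_mul]; linarith)
    (pointwise_bound hs hr0 hr (by linarith) hq hp1 hsymm hpq)
  refine hmain.trans ?_
  have hw : Measurable fun x => ENNReal.ofReal (max (u x - k) 0) :=
    (measurable_posPart_comp hu.1).ennreal_ofReal
  have hg := (measurable_gagliardo (s := s) hpc hu.1).indicator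
    (measurableSet_belowLevel (k := k) (m := m) hu.1).compl
  have hH := (measurable_localDensity (s := s) (k := k) (r := r) (R := R) hpc hu.1).indicator
    ((measurableSet_ball (x := x₀) (ε := R)).prod (measurableSet_ball (x := x₀) (ε := R)))
  have hT : Measurable ((ball x₀ ((R + r) / 2) ×ˢ (ball x₀ R)ᶜ).indicator (fun z =>
        ENNReal.ofReal (max (u z.1 - k) 0) * tailDensity s p u k x₀ r R z)) :=
    ((hw.comp measurable_fst).mul (measurable_tailDensity hpc hu.1)).indicator
      (measurableSet_ball.prod measurableSet_ball.compl)
  have hHint : ∫⁻ z, (ball x₀ R ×ˢ ball x₀ R).indicator (localDensity s p u k r R) z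
      = ∫⁻ x in ball x₀ R, ∫⁻ y in ball x₀ R, localDensity s p u k r R (x, y) := by
    rw [lintegral_indicator (measurableSet_ball.prod measurableSet_ball), Measure.volume_eq_prod,
      setLIntegral_prod _ (measurable_localDensity hpc hu.1).aemeasurable]
  have hTle := lintegral_tail_le (s := s) (k := k) (x₀ := x₀) hpc hu.1 hr
  refine (lintegral_add_symmetrized (ENNReal.ofReal ((4 * q) ^ q)) hg hH hT).le.trans ?_
  rw [hHint, add_assoc]
  have hq0 : 0 ≤ (4 * q) ^ q := by positivity
  have hc1 : ENNReal.ofReal ((4 * q) ^ q) * 2 ≤ ENNReal.ofReal (4 + 2 * (4 * q) ^ q) := by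
    rw [mul_comm, two_mul, ← ENNReal.ofReal_add hq0 hq0]
    exact ENNReal.ofReal_le_ofReal (by linarith)
  have hc2 : (2 : ℝ≥0∞) * 2 ≤ ENNReal.ofReal (4 + 2 * (4 * q) ^ q) := by
    rw [ENNReal.ofReal_add (by norm_num) (by positivity), ENNReal.ofReal_ofNat]
    exact (by norm_num : (2 : ℝ≥0∞) * 2 = 4).le.trans le_self_add
  refine add_le_add_right (add_le_add ?_ ?_) _
  · rw [← two_mul, ← mul_assoc]
    exact mul_le_mul_left hc1 _
  · rw [← two_mul, ← mul_assoc, mul_assoc (ENNReal.ofReal _)]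
    exact mul_le_mul' hc2 hTle

lemma tendsto_lintegral_aboveLevel (hpc : Continuous fun z : Rn n × Rn n => p z.1 z.2)
    (hu : MemW s p u) :
    Tendsto (fun j : ℕ => ∫⁻ z, (belowLevel u k (j + 1))ᶜ.indicator (fun z =>
      ENNReal.ofReal (|u z.1 - u z.2| ^ p z.1 z.2
          / ‖z.1 - z.2‖ ^ ((n : ℝ) + s * p z.1 z.2))) z) atTop (𝓝 0) := by
  have hg := measurable_gagliardo (s := s) hpc hu.1
  have h := tendsto_lintegral_of_dominated_convergence (μ := volume) (f := fun _ => 0)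
    (F := fun j : ℕ => (belowLevel u k (j + 1))ᶜ.indicator (fun z =>
      ENNReal.ofReal (|u z.1 - u z.2| ^ p z.1 z.2
          / ‖z.1 - z.2‖ ^ ((n : ℝ) + s * p z.1 z.2)))) _
    (fun j => hg.indicator (measurableSet_belowLevel hu.1).compl)
    (fun j => Eventually.of_forall fun z => indicator_le_self _ _ z) ?_ ?_
  · simpa using h
  · rw [Measure.volume_eq_prod, lintegral_prod _ hg.aemeasurable]
    exact hu.2.2.ne
  · refine Eventually.of_forall fun z => tendsto_const_nhds.congr' ?_
    filter_upwards [eventually_ge_atTop ⌈max (max (u z.1 - k) 0) (max (u z.2 - k) 0)⌉₊] with j hj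
    have h1 := (max_le_iff.1 (Nat.ceil_le.1 hj))
    rw [indicator_of_notMem]
    exact not_not.2 ⟨by linarith [h1.1], by linarith [h1.2]⟩

lemma tendsto_lintegral_belowLevel (hpc : Continuous fun z : Rn n × Rn n => p z.1 z.2)
    (hu : Measurable u) :
    Tendsto (fun j : ℕ => ∫⁻ z, (belowLevel u k (j + 1)).indicator
      (caccioppoliDensity s p u k x₀ r R) z) atTop
      (𝓝 (∫⁻ z, caccioppoliDensity s p u k x₀ r R z)) := by
  refine lintegral_tendsto_of_tendsto_of_monotone
    (fun j => ((measurable_caccioppoliDensity hpc hu).indicator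
      (measurableSet_belowLevel hu)).aemeasurable)
    (Eventually.of_forall fun z i j hij => ?_) (Eventually.of_forall fun z => ?_)
  · refine indicator_le_indicator_of_subset (fun w hw => ?_) (fun _ => zero_le) z
    have : (i : ℝ) ≤ j := by exact_mod_cast hij
    exact ⟨by linarith [hw.1], by linarith [hw.2]⟩
  · refine tendsto_const_nhds.congr' ?_
    filter_upwards [eventually_ge_atTop ⌈max (max (u z.1 - k) 0) (max (u z.2 - k) 0)⌉₊] with j hj
    have h1 := (max_le_iff.1 (Nat.ceil_le.1 hj))
    rw [indicator_of_mem]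
    exact ⟨by linarith [h1.1], by linarith [h1.2]⟩

end integrated

/-- Caccioppoli-type estimate; the constant `C` depends only on
`p₊(B_R(x₀) × B_R(x₀))` and `p₋(B_R(x₀) × B_R(x₀))`. -/
theorem statement4 :
    ∃ C : ℝ → ℝ → ℝ, (∀ a b : ℝ, 0 < C a b) ∧
    ∀ (n : ℕ), 1 ≤ n → ∀ s : ℝ, s ∈ Set.Ioo (0:ℝ) 1 →
    ∀ p : Rn n → Rn n → ℝ, ExponentOK p →
    ∀ Ω : Set (Rn n), IsOpen Ω → Bornology.IsBounded Ω →
    ∀ u : Rn n → ℝ, MemW s p u → IsWeakSubsol s p Ω u →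
    ∀ (x₀ : Rn n) (r R k : ℝ), 0 < r → r < R → ball x₀ R ⊆ Ω →
      (∫⁻ x in ball x₀ r, ∫⁻ y in ball x₀ r,
          ENNReal.ofReal (|max (u x - k) 0 - max (u y - k) 0| ^ p x y
            / ‖x - y‖ ^ ((n : ℝ) + s * p x y))) +
      (∫⁻ x in ball x₀ r, ENNReal.ofReal (max (u x - k) 0) *
          ∫⁻ y in ball x₀ R,
            ENNReal.ofReal ((max (k - u y) 0) ^ (p x y - 1)
              / ‖x - y‖ ^ ((n : ℝ) + s * p x y)))
      ≤ ENNReal.ofReal (C (pSup p (ball x₀ R) (ball x₀ R)) (pInf p (ball x₀ R) (ball x₀ R))) *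
          (∫⁻ x in ball x₀ R, ∫⁻ y in ball x₀ R,
            ENNReal.ofReal ((max (u x - k) 0 / (R - r)) ^ p x y
              / ‖x - y‖ ^ ((n : ℝ) - (1 - s) * p x y))) +
        ENNReal.ofReal (C (pSup p (ball x₀ R) (ball x₀ R)) (pInf p (ball x₀ R) (ball x₀ R))) *
          (⨆ x ∈ ball x₀ ((R + r) / 2), ∫⁻ y in (ball x₀ R)ᶜ,
            ENNReal.ofReal ((max (u y - k) 0) ^ (p x y - 1)
              / ‖y - x₀‖ ^ ((n : ℝ) + s * p x y)
              * (2 * R / (R - r)) ^ ((n : ℝ) + s * p x y))) *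
          (∫⁻ x in ball x₀ R, ENNReal.ofReal (max (u x - k) 0)) := by
  refine ⟨fun a _ => 4 + 2 * (4 * |a|) ^ a, fun a _ => by positivity, ?_⟩
  intro n hn s hs p hp Ω _ _ u hu hsub x₀ r R k hr0 hr hΩ
  have hpc := hp.1
  obtain ⟨pm, pM, hpm, hb⟩ := hp.2.2
  set q := pSup p (ball x₀ R) (ball x₀ R)
  have hpq : ∀ x ∈ ball x₀ R, ∀ y ∈ ball x₀ R, p x y ≤ q := fun x hx y hy =>
    le_csSup ⟨pM, by rintro _ ⟨a, -, b, -, rfl⟩; exact (hb a b).2⟩ (mem_image2_of_mem hx hy)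
  have hx₀ : x₀ ∈ ball x₀ R := mem_ball_self (hr0.trans hr)
  have hq : 1 < q := by linarith [hpq x₀ hx₀ x₀ hx₀, (hb x₀ x₀).1]
  rw [← lintegral_caccioppoliDensity hpc hu.1]
  simp only [abs_of_pos (zero_lt_one.trans hq)]
  refine le_of_tendsto_of_tendsto' (tendsto_lintegral_belowLevel hpc hu.1) ?_
    fun j : ℕ => caccioppoli_belowLevel hn hs hp hu hsub hr0 hr hΩ
      (le_add_of_nonneg_left (Nat.cast_nonneg j)) hq hpq
  have := (tendsto_lintegral_aboveLevel (k := k) hpc hu).add_const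
    (ENNReal.ofReal (4 + 2 * (4 * q) ^ q) *
            (∫⁻ x in ball x₀ R, ∫⁻ y in ball x₀ R, localDensity s p u k r R (x, y))
          + ENNReal.ofReal (4 + 2 * (4 * q) ^ q) *
            (⨆ x ∈ ball x₀ ((R + r) / 2),
              ∫⁻ y in (ball x₀ R)ᶜ, tailDensity s p u k x₀ r R (x, y)) *
            (∫⁻ x in ball x₀ R, ENNReal.ofReal (max (u x - k) 0)))
  rwa [zero_add] at this
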